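/- Let V be a finite-dimensional vector space over ℚ of dimension at least 3, equipped with a nondegenerate quadratic form q, and let f : V → V be a linear endomorphism that commutes with every isometry of q of determinant 1 (i.e. f ∘ g = g ∘ f for every linear automorphism g of V with q(g v) = q(v) for all v and det g = 1). Then f is a scalar, i.e. there exists c ∈ ℚ with f(v) = c·v for all v ∈ V. -/

import Mathlib

namespace QuadraticMap

variable {K V : Type*} [Field K] [AddCommGroup V] [Module K V]

/-- The linear functional `v ↦ polar q x v / q x` defining the reflection in `x`. -/
def coroot (q : QuadraticForm K V) (x : V) : Module.Dual K V :=
  (q x)⁻¹ • q.polarBilin x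

lemma coroot_apply (q : QuadraticForm K V) (x v : V) :
    q.coroot x v = (q x)⁻¹ * polar q x v := rfl

lemma coroot_self {q : QuadraticForm K V} {x : V} (hx : q x ≠ 0) : q.coroot x x = 2 := by
  rw [coroot_apply, polar_self, nsmul_eq_mul, Nat.cast_ofNat]
  field_simp

lemma map_reflection_coroot {q : QuadraticForm K V} {x : V} (hx : q x ≠ 0) (v : V) :
    q (Module.reflection (coroot_self hx) v) = q v := by
  rw [Module.reflection_apply, sub_eq_add_neg, ← neg_smul, QuadraticMap.map_add q,
    QuadraticMap.map_smul, polar_smul_right, coroot_apply, polar_comm q v x]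
  simp only [smul_eq_mul]
  field_simp
  ring

lemma det_reflection_coroot {q : QuadraticForm K V} [FiniteDimensional K V] {x : V}
    (hx : q x ≠ 0) :
    LinearMap.det (Module.reflection (coroot_self hx) : V →ₗ[K] V) = -1 := by
  have h : (Module.reflection (coroot_self hx) : V →ₗ[K] V) =
      LinearMap.transvection (-q.coroot x) x := by
    ext v
    simp [Module.reflection_apply, LinearMap.transvection.apply, sub_eq_add_neg]
  rw [h, LinearMap.transvection.det, LinearMap.neg_apply, coroot_self hx]
  ring

/-- An endomorphism commuting with the determinant one isometries of `q` maps `x` into the plane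
spanned by `x` and `y`, for orthogonal anisotropic `x` and `y`. -/
lemma exists_eq_smul_add_smul_of_commute [NeZero (2 : K)] [FiniteDimensional K V]
    {q : QuadraticForm K V} {f : V →ₗ[K] V}
    (hcomm : ∀ g : V ≃ₗ[K] V, (∀ v : V, q (g v) = q v) →
      LinearMap.det (g : V →ₗ[K] V) = 1 →
        f ∘ₗ (g : V →ₗ[K] V) = (g : V →ₗ[K] V) ∘ₗ f)
    {x y : V} (hx : q x ≠ 0) (hy : q y ≠ 0) (hxy : polar q x y = 0) :
    ∃ a b : K, f x = a • x + b • y := by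
  have h := hcomm ((Module.reflection (coroot_self hx)).trans
    (Module.reflection (coroot_self hy)))
    (fun v => by
      rw [LinearEquiv.trans_apply, map_reflection_coroot hy, map_reflection_coroot hx])
    (by
      rw [LinearEquiv.coe_trans, LinearMap.det_comp, det_reflection_coroot hy,
        det_reflection_coroot hx]
      ring)
  have hyx : q.coroot y x = 0 := by rw [coroot_apply, polar_comm, hxy, mul_zero]
  have h' := LinearMap.congr_fun h x
  simp only [LinearMap.comp_apply, LinearEquiv.coe_coe, LinearEquiv.trans_apply,
    Module.reflection_apply_self, Module.reflection_apply, map_neg, map_sub, map_smul, hyx,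
    zero_smul, sub_zero] at h'
  have h2 : (2 : K) • f x = q.coroot x (f x) • x + q.coroot y (f x) • y := by
    rw [two_smul]
    linear_combination (norm := module) (-1 : K) • h'
  refine ⟨2⁻¹ * q.coroot x (f x), 2⁻¹ * q.coroot y (f x), ?_⟩
  rw [mul_smul, mul_smul, ← smul_add, ← h2, inv_smul_smul₀ two_ne_zero]

end QuadraticMap

/-- The commutant of `SO(V,q)(ℚ)` in `End(V)` consists of the scalars: if `V` is a
rational vector space of dimension `≥ 3` with a nondegenerate quadratic form `q`, and
`f : V →ₗ[ℚ] V` commutes with every isometry of `q` of determinant `1`, then `f` is a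
scalar multiple of the identity. -/
theorem commutant_of_special_orthogonal_group_eq_scalars
    {V : Type*} [AddCommGroup V] [Module ℚ V] [FiniteDimensional ℚ V]
    (hdim : 3 ≤ Module.finrank ℚ V)
    (q : QuadraticForm ℚ V) (hq : LinearMap.BilinForm.Nondegenerate q.polarBilin)
    (f : V →ₗ[ℚ] V)
    (hcomm : ∀ g : V ≃ₗ[ℚ] V, (∀ v : V, q (g v) = q v) →
      LinearMap.det (g : V →ₗ[ℚ] V) = 1 →
        f ∘ₗ (g : V →ₗ[ℚ] V) = (g : V →ₗ[ℚ] V) ∘ₗ f) :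
    ∃ c : ℚ, ∀ v : V, f v = c • v := by
  obtain ⟨e, he⟩ := LinearMap.BilinForm.exists_orthogonal_basis
    (B := q.polarBilin) ⟨fun x y => QuadraticMap.polar_comm q x y⟩
  have horth : ∀ {i j}, i ≠ j → QuadraticMap.polar q (e i) (e j) = 0 := fun h => he h
  have hself : ∀ v, QuadraticMap.polar q v v = 2 * q v := fun v => by
    rw [QuadraticMap.polar_self, nsmul_eq_mul, Nat.cast_ofNat]
  have hne : ∀ i, q (e i) ≠ 0 := fun i h =>
    he.not_isOrtho_basis_self_of_separatingLeft hq.1 i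
      (show QuadraticMap.polar q (e i) (e i) = 0 by rw [hself, h, mul_zero])
  have heig : ∀ i, ∃ c : ℚ, f (e i) = c • e i := by
    intro i
    obtain ⟨j, hji, -⟩ := Fin.exists_ne_and_ne_of_two_lt i i hdim
    obtain ⟨k, hki, hkj⟩ := Fin.exists_ne_and_ne_of_two_lt i j hdim
    obtain ⟨a, b, h⟩ := QuadraticMap.exists_eq_smul_add_smul_of_commute hcomm (hne i) (hne j)
      (horth hji.symm)
    obtain ⟨a', b', h'⟩ := QuadraticMap.exists_eq_smul_add_smul_of_commute hcomm (hne i) (hne k)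
      (horth hki.symm)
    have hb : b = 0 := by
      have := congrArg (QuadraticMap.polar q (e j)) (h.symm.trans h')
      simpa [QuadraticMap.polar_add_right, QuadraticMap.polar_smul_right, horth hji,
        horth hkj.symm, hself, hne j] using this
    exact ⟨a, by rw [h, hb, zero_smul, add_zero]⟩
  choose c hc using heig
  have hconst : ∀ i j, c i = c j := by
    intro i j
    obtain rfl | hij := eq_or_ne i j
    · rfl
    obtain ⟨k, hki, hkj⟩ := Fin.exists_ne_and_ne_of_two_lt i j hdim
    have hq_add : ∀ t : ℚ, q (e i + t • e j) = q (e i) + t * t * q (e j) := fun t => by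
      rw [QuadraticMap.map_add q, QuadraticMap.map_smul, QuadraticMap.polar_smul_right, horth hij]
      simp
    obtain ⟨t, ht, hqt⟩ : ∃ t : ℚ, t ≠ 0 ∧ q (e i + t • e j) ≠ 0 := by
      by_contra! H
      have h1 := H 1 one_ne_zero
      have h2 := H 2 two_ne_zero
      rw [hq_add] at h1 h2
      exact hne j (by linarith)
    obtain ⟨a, b, h⟩ := QuadraticMap.exists_eq_smul_add_smul_of_commute hcomm hqt (hne k) (by
      rw [QuadraticMap.polar_add_left, QuadraticMap.polar_smul_left, horth hki.symm,
        horth hkj.symm, smul_zero, add_zero])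
    rw [map_add, map_smul, hc, hc] at h
    have hi := congrArg (QuadraticMap.polar q (e i)) h
    have hj := congrArg (QuadraticMap.polar q (e j)) h
    simp only [QuadraticMap.polar_add_right, QuadraticMap.polar_smul_right, horth hij,
      horth hij.symm, horth hki.symm, horth hkj.symm, hself, smul_eq_mul, mul_zero, add_zero,
      zero_add] at hi hj
    have hi' : c i = a := mul_right_cancel₀ (mul_ne_zero two_ne_zero (hne i)) hi
    have hj' : c j = a := by
      refine mul_right_cancel₀ (mul_ne_zero ht (mul_ne_zero two_ne_zero (hne j))) ?_
      linear_combination hj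
    rw [hi', hj']
  let i₀ : Fin (Module.finrank ℚ V) := ⟨0, by omega⟩
  have hf : f = c i₀ • LinearMap.id := e.ext fun i => by
    rw [hc, hconst i i₀, LinearMap.smul_apply, LinearMap.id_apply]
  exact ⟨c i₀, fun v => by rw [hf, LinearMap.smul_apply, LinearMap.id_apply]⟩
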